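/- Let N ≥ 2 and let H be an H-matrix satisfying the H-invariance conditions, i.e. P(N−1,m;H) = (1/N)·C(N,m+1) for all m = 1,…,N−1, and suppose λ*_{k,j}(H) ≥ 0 for all 1 ≤ j < k ≤ N. Then for every d ≥ 1, every nonexpansive T : ℝ^d → ℝ^d with a fixed point y⋆, and every y₀ ∈ ℝ^d, the iterates of the H-matrix algorithm satisfy ‖y_{N−1} − T y_{N−1}‖² ≤ 4‖y₀ − y⋆‖²/N². -/

import Mathlib

open Finset

/-- `Pinv H k m` is `P(k,m;H)`: the sum over all index sequences
`1 ≤ j(1) ≤ i(1) < j(2) ≤ i(2) < ⋯ < j(m) ≤ i(m) ≤ k` of `∏_{r} h_{i(r),j(r)}`,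
with `P(k,0;H) = 1`. -/
noncomputable def Pinv (H : ℕ → ℕ → ℝ) (k : ℕ) : ℕ → ℝ
  | 0 => 1
  | m + 1 =>
    ∑ f : Fin (m + 1) → Fin (k + 1) × Fin (k + 1),
      if (∀ r, 1 ≤ ((f r).2 : ℕ) ∧ ((f r).2 : ℕ) ≤ ((f r).1 : ℕ)) ∧
          (∀ r : Fin m, ((f r.castSucc).1 : ℕ) < ((f r.succ).2 : ℕ)) then
        ∏ r, H ((f r).1 : ℕ) ((f r).2 : ℕ)
      else 0

/-- `Qinv H k m j` is `Q(k,m,j;H)`: the partial sum of `P(k,m;H)` over those index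
sequences with `j(1) = j` (zero if no such sequence exists, and zero for `m = 0`). -/
noncomputable def Qinv (H : ℕ → ℕ → ℝ) (k : ℕ) : ℕ → ℕ → ℝ
  | 0, _ => 0
  | m + 1, j =>
    ∑ f : Fin (m + 1) → Fin (k + 1) × Fin (k + 1),
      if (∀ r, 1 ≤ ((f r).2 : ℕ) ∧ ((f r).2 : ℕ) ≤ ((f r).1 : ℕ)) ∧
          (∀ r : Fin m, ((f r.castSucc).1 : ℕ) < ((f r.succ).2 : ℕ)) ∧
          ((f 0).2 : ℕ) = j then
        ∏ r, H ((f r).1 : ℕ) ((f r).2 : ℕ)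
      else 0

/-- The H-certificates `λ*_{k,j}(H)`:
`λ*_{N,j}(H) = N·Σ_{m=1}^{N−j} (−1)^{m−1}·Q(N−1,m,j;H)` for `j = 1,…,N−1`, and
`λ*_{k,j}(H) = N·Σ_{ℓ=1}^{N−j} Σ_{m=1}^{N−k} (−1)^{ℓ+m−1}·C(ℓ+m,m)·Q(N−1,ℓ,j;H)·Q(N−1,m,k;H)`
for `1 ≤ j < k ≤ N−1`. -/
noncomputable def lamStar (N : ℕ) (H : ℕ → ℕ → ℝ) (k j : ℕ) : ℝ :=
  if k = N then
    (N : ℝ) * ∑ m ∈ Finset.Icc 1 (N - j), (-1 : ℝ) ^ (m - 1) * Qinv H (N - 1) m j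
  else
    (N : ℝ) * ∑ l ∈ Finset.Icc 1 (N - j), ∑ m ∈ Finset.Icc 1 (N - k),
      (-1 : ℝ) ^ (l + m - 1) * (Nat.choose (l + m) m : ℝ) *
        Qinv H (N - 1) l j * Qinv H (N - 1) m k

/-- The double sum of `(-1)^(l+m) C(l+m,m)` against `B (m+1) l + B m l / 2` collapses to its
corner value for a symmetric array `B` supported on indices below `N`. -/
theorem sum_alternating_choose_mul_symm (N : ℕ) (hN : 0 < N) (B : ℕ → ℕ → ℝ)
    (hsymm : ∀ a b, B a b = B b a) (hvanish : ∀ b, B N b = 0) :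
    ∑ l ∈ range N, ∑ m ∈ range N,
      (-1 : ℝ) ^ (l + m) * ((l + m).choose m : ℝ) * (B (m + 1) l + B m l / 2) = B 0 0 / 2 := by
  obtain ⟨V, hV⟩ : ∃ V : ℕ → ℕ → ℝ, V = fun a l =>
      (-1 : ℝ) ^ (l + a) * (if a = 0 then 0 else ((a + l - 1).choose l : ℝ)) * B a l := ⟨_, rfl⟩
  have hshift : ∀ l, ∑ m ∈ range N, (-1 : ℝ) ^ (l + m) * ((l + m).choose m : ℝ) * B (m + 1) l
      = -∑ m ∈ range N, V m l := by
    intro l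
    have h1 : ∑ m ∈ range (N + 1), V m l = ∑ m ∈ range N, V m l := by
      rw [sum_range_succ]; simp [hV, hvanish]
    rw [← h1, sum_range_succ']
    have h0 : V 0 l = 0 := by simp [hV]
    rw [h0, add_zero, ← sum_neg_distrib]
    refine sum_congr rfl fun m _ => ?_
    have h2 : m + 1 + l - 1 = l + m := by omega
    simp only [hV, h2, Nat.succ_ne_zero, if_false]
    rw [Nat.choose_symm_add]
    ring
  have hpair : ∀ a l, V a l + V l a =
      (-1 : ℝ) ^ (l + a) * ((l + a).choose a : ℝ) * B a l
        - if l = 0 then (if a = 0 then B 0 0 else 0) else 0 := by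
    intro a l
    rcases a with _ | a <;> rcases l with _ | l
    · simp [hV]
    · simp [hV, hsymm 0 (l + 1)]
    · simp [hV]
    · have h1 : a + 1 + (l + 1) - 1 = a + l + 1 := by omega
      have h2 : l + 1 + (a + 1) - 1 = a + l + 1 := by omega
      have h3 : l + 1 + (a + 1) = a + l + 1 + 1 := by omega
      have h4 : (a + l + 1).choose (l + 1) = (a + l + 1).choose a :=
        Nat.choose_symm_of_eq_add (by omega)
      simp only [hV, h1, h2, Nat.succ_ne_zero, if_false, sub_zero]
      rw [hsymm (l + 1) (a + 1), h4, show a + 1 + (l + 1) = l + 1 + (a + 1) by omega, h3,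
        Nat.choose_succ_succ (a + l + 1) a]
      push_cast
      ring
  have hsum : ∑ l ∈ range N, ∑ m ∈ range N, V m l + ∑ l ∈ range N, ∑ m ∈ range N, V m l
      = ∑ l ∈ range N, ∑ m ∈ range N, (-1 : ℝ) ^ (l + m) * ((l + m).choose m : ℝ) * B m l
        - B 0 0 := by
    nth_rewrite 2 [sum_comm]
    simp only [← sum_add_distrib, hpair, sum_sub_distrib]
    simp [hN, Finset.sum_ite_eq']
  have hsplit : ∀ l m, (-1 : ℝ) ^ (l + m) * ((l + m).choose m : ℝ) * (B (m + 1) l + B m l / 2)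
      = (-1 : ℝ) ^ (l + m) * ((l + m).choose m : ℝ) * B (m + 1) l
        + (1 / 2) * ((-1 : ℝ) ^ (l + m) * ((l + m).choose m : ℝ) * B m l) := by
    intro l m; ring
  simp only [hsplit, sum_add_distrib, hshift, sum_neg_distrib, ← mul_sum]
  linarith

/-- The `n`-th alternating binomial sum annihilates `s ↦ C(a+s,l)` when `l < n`. -/
theorem sum_neg_one_pow_choose_mul_choose_eq_zero (n : ℕ) : ∀ l a : ℕ, l < n →
    ∑ s ∈ range (n + 1), (-1 : ℝ) ^ s * (n.choose s : ℝ) * ((a + s).choose l : ℝ) = 0 := by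
  induction n with
  | zero => intro l a h; omega
  | succ n ih =>
    intro l a h
    have hstep : ∑ s ∈ range (n + 1 + 1),
        (-1 : ℝ) ^ s * ((n + 1).choose s : ℝ) * ((a + s).choose l : ℝ)
        = ∑ s ∈ range (n + 1), (-1 : ℝ) ^ s * (n.choose s : ℝ) *
          (((a + s).choose l : ℝ) - ((a + s + 1).choose l : ℝ)) := by
      have h1 : ∑ s ∈ range (n + 1), (-1 : ℝ) ^ s * (n.choose s : ℝ) * ((a + s).choose l : ℝ)
          = ∑ s ∈ range (n + 1), (-1 : ℝ) ^ (s + 1) * (n.choose (s + 1) : ℝ)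
              * ((a + (s + 1)).choose l : ℝ) + (a.choose l : ℝ) := by
        have h2 := sum_range_succ
          (fun s => (-1 : ℝ) ^ s * (n.choose s : ℝ) * ((a + s).choose l : ℝ)) (n + 1)
        rw [sum_range_succ'] at h2
        simp only [Nat.choose_succ_self, Nat.cast_zero, mul_zero, zero_mul, add_zero] at h2
        rw [← h2]
        simp
      simp only [mul_sub, sum_sub_distrib]
      rw [h1, sum_range_succ', add_sub_right_comm, ← sum_sub_distrib]
      congr 1
      · refine sum_congr rfl fun s _ => ?_
        rw [Nat.choose_succ_succ', ← add_assoc]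
        push_cast
        ring
      · simp
    rw [hstep]
    rcases l with _ | l
    · simp
    · have h3 := ih l a (by omega)
      rw [← neg_eq_zero, ← sum_neg_distrib, ← h3]
      refine sum_congr rfl fun s _ => ?_
      rw [Nat.choose_succ_succ (a + s) l]
      push_cast
      ring

theorem sum_neg_one_pow_choose_add_mul_choose_succ (N l : ℕ) (hl : l < N) :
    ∑ m ∈ range N, (-1 : ℝ) ^ m * ((l + m).choose m : ℝ) * (N.choose (m + 1) : ℝ)
      = if l = 0 then 1 else 0 := by
  have h := sum_neg_one_pow_choose_mul_choose_eq_zero N l (l - 1) hl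
  rw [sum_range_succ'] at h
  have h1 : ∑ m ∈ range N, (-1 : ℝ) ^ m * ((l + m).choose m : ℝ) * (N.choose (m + 1) : ℝ)
      = -∑ m ∈ range N, (-1 : ℝ) ^ (m + 1) * (N.choose (m + 1) : ℝ)
          * ((l - 1 + (m + 1)).choose l : ℝ) := by
    rw [← sum_neg_distrib]
    refine sum_congr rfl fun m _ => ?_
    have h2 : (l - 1 + (m + 1)).choose l = (l + m).choose m := by
      rcases l with _ | l
      · simp
      · rw [← Nat.choose_symm_add]; congr 1; omega
    rw [h2]
    ring
  rw [h1]
  rcases l with _ | l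
  · simp at h ⊢
    linarith
  · simp at h ⊢
    linarith

theorem sum_comm_pairs {ι R : Type*} [AddCommMonoid R] (s : Finset ι) (f : ι → ι → ι → ι → R) :
    ∑ a ∈ s, ∑ b ∈ s, ∑ c ∈ s, ∑ d ∈ s, f a b c d
      = ∑ c ∈ s, ∑ d ∈ s, ∑ a ∈ s, ∑ b ∈ s, f a b c d := by
  have h (a : ι) : ∑ b ∈ s, ∑ c ∈ s, ∑ d ∈ s, f a b c d
      = ∑ c ∈ s, ∑ d ∈ s, ∑ b ∈ s, f a b c d := by
    rw [sum_comm]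
    exact sum_congr rfl fun c _ => sum_comm
  simp only [h]
  rw [sum_comm]
  exact sum_congr rfl fun c _ => sum_comm

/-- The symmetric matrix whose off-diagonal entries are the negated certificates, built from the
coefficient vectors `q 0, q 1, …, q (N-1)`. -/
noncomputable def certMatrix (N : ℕ) (q : ℕ → ℕ → ℝ) (k j : ℕ) : ℝ :=
  (N : ℝ) * ∑ l ∈ range N, ∑ m ∈ range N,
    (-1 : ℝ) ^ (l + m) * ((l + m).choose m : ℝ) * (q l j * q m k)

theorem certMatrix_symm (N : ℕ) (q : ℕ → ℕ → ℝ) (k j : ℕ) :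
    certMatrix N q k j = certMatrix N q j k := by
  unfold certMatrix
  rw [sum_comm]
  congr 1
  refine sum_congr rfl fun l _ => sum_congr rfl fun m _ => ?_
  rw [add_comm m l, Nat.choose_symm_add]
  ring

theorem sum_certMatrix (N : ℕ) (q : ℕ → ℕ → ℝ) (k : ℕ)
    (hsum : ∀ m < N, ∑ j ∈ range N, q m j = 1 / (N : ℝ) * (N.choose (m + 1) : ℝ)) (hN : 0 < N) :
    ∑ j ∈ range N, certMatrix N q k j = q 0 k := by
  have hN' : (N : ℝ) ≠ 0 := by positivity
  unfold certMatrix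
  rw [← mul_sum, sum_comm]
  have h1 : ∀ l ∈ range N, ∑ j ∈ range N, ∑ m ∈ range N,
      (-1 : ℝ) ^ (l + m) * ((l + m).choose m : ℝ) * (q l j * q m k)
      = ∑ m ∈ range N, (-1 : ℝ) ^ m * q m k / N *
          ((-1 : ℝ) ^ l * ((m + l).choose l : ℝ) * (N.choose (l + 1) : ℝ)) := by
    intro l hl
    rw [sum_comm]
    refine sum_congr rfl fun m _ => ?_
    rw [← mul_sum, ← sum_mul, hsum l (mem_range.1 hl), add_comm m l, Nat.choose_symm_add]
    ring
  rw [sum_congr rfl h1, sum_comm]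
  have h2 : ∀ m ∈ range N, ∑ l ∈ range N, (-1 : ℝ) ^ m * q m k / N *
          ((-1 : ℝ) ^ l * ((m + l).choose l : ℝ) * (N.choose (l + 1) : ℝ))
      = if m = 0 then q 0 k / N else 0 := by
    intro m hm
    rw [← mul_sum, sum_neg_one_pow_choose_add_mul_choose_succ N m (mem_range.1 hm)]
    split_ifs with h
    · simp [h]
    · simp
  rw [sum_congr rfl h2]
  simp [hN, mul_div_cancel₀, hN']

theorem sum_certMatrix_mul_inner {E : Type*} [NormedAddCommGroup E] [InnerProductSpace ℝ E]
    (N : ℕ) (hN : 0 < N) (q S : ℕ → ℕ → ℝ) (g x : ℕ → E) (x₀ : E)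
    (hq0 : ∀ j < N, q 0 j = if j = N - 1 then 1 else 0)
    (hstep : ∀ m, ∀ l < N, q (m + 1) l = ∑ k ∈ range N, q m k * S k l)
    (hqN : ∀ j < N, q N j = 0)
    (hsum : ∀ m < N, ∑ j ∈ range N, q m j = 1 / (N : ℝ) * (N.choose (m + 1) : ℝ))
    (hx : ∀ k < N, x k = x₀ - ∑ l ∈ range N, S k l • g l - (1 / 2 : ℝ) • g k) :
    ∑ k ∈ range N, ∑ j ∈ range N, certMatrix N q k j * inner ℝ (x k) (g j)
      = inner ℝ x₀ (g (N - 1)) - (N : ℝ) / 2 * ‖g (N - 1)‖ ^ 2 := by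
  obtain ⟨G, hG⟩ : ∃ G : ℕ → E, G = fun m => ∑ j ∈ range N, q m j • g j := ⟨_, rfl⟩
  have hG0 : G 0 = g (N - 1) := by
    have : ∀ j ∈ range N, q 0 j • g j = if j = N - 1 then g j else 0 := by
      intro j hj
      rw [hq0 j (mem_range.1 hj)]
      split_ifs <;> simp
    simp only [hG]
    rw [sum_congr rfl this]
    simp
    omega
  have hGN : G N = 0 := by
    simp only [hG]
    exact sum_eq_zero fun j hj => by rw [hqN j (mem_range.1 hj), zero_smul]
  have hGsucc : ∀ m, G (m + 1) = ∑ k ∈ range N, q m k • ∑ l ∈ range N, S k l • g l := by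
    intro m
    simp only [hG, smul_sum, smul_smul]
    rw [sum_comm]
    exact sum_congr rfl fun l hl => by rw [hstep m l (mem_range.1 hl), sum_smul]
  have hX : ∀ m < N, ∑ k ∈ range N, q m k • x k
      = (1 / (N : ℝ) * (N.choose (m + 1) : ℝ)) • x₀ - G (m + 1) - (1 / 2 : ℝ) • G m := by
    intro m hm
    rw [hGsucc, ← hsum m hm, sum_smul]
    simp only [hG, smul_sum]
    rw [← sum_sub_distrib, ← sum_sub_distrib]
    refine sum_congr rfl fun k hk => ?_
    rw [hx k (mem_range.1 hk), smul_sub, smul_sub, smul_comm (1 / 2 : ℝ), smul_sum]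
  have hexpand : ∑ k ∈ range N, ∑ j ∈ range N, certMatrix N q k j * inner ℝ (x k) (g j)
      = N * ∑ l ∈ range N, ∑ m ∈ range N, (-1 : ℝ) ^ (l + m) * ((l + m).choose m : ℝ) *
          inner ℝ (∑ k ∈ range N, q m k • x k) (G l) := by
    have hinner : ∀ l m, inner ℝ (∑ k ∈ range N, q m k • x k) (G l)
        = ∑ k ∈ range N, ∑ j ∈ range N, q l j * q m k * inner ℝ (x k) (g j) := by
      intro l m
      rw [sum_inner]
      refine sum_congr rfl fun k _ => ?_
      simp only [hG, inner_sum]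
      refine sum_congr rfl fun j _ => ?_
      rw [real_inner_smul_left, real_inner_smul_right]
      ring
    simp only [hinner, certMatrix, mul_sum, sum_mul]
    rw [sum_comm_pairs]
    refine sum_congr rfl fun l _ => sum_congr rfl fun m _ => sum_congr rfl fun k _ =>
      sum_congr rfl fun j _ => ?_
    ring
  have hterm : ∀ l ∈ range N, ∀ m ∈ range N, (-1 : ℝ) ^ (l + m) * ((l + m).choose m : ℝ) *
          inner ℝ (∑ k ∈ range N, q m k • x k) (G l)
      = (-1 : ℝ) ^ l * inner ℝ x₀ (G l) / N *
          ((-1 : ℝ) ^ m * ((l + m).choose m : ℝ) * (N.choose (m + 1) : ℝ))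
        - (-1 : ℝ) ^ (l + m) * ((l + m).choose m : ℝ) *
          (inner ℝ (G (m + 1)) (G l) + inner ℝ (G m) (G l) / 2) := by
    intro l _ m hm
    rw [hX m (mem_range.1 hm)]
    simp only [inner_sub_left, real_inner_smul_left]
    ring
  have hmain : ∀ l ∈ range N, ∑ m ∈ range N, (-1 : ℝ) ^ l * inner ℝ x₀ (G l) / N *
          ((-1 : ℝ) ^ m * ((l + m).choose m : ℝ) * (N.choose (m + 1) : ℝ))
      = if l = 0 then inner ℝ x₀ (G 0) / N else 0 := by
    intro l hl
    rw [← mul_sum, sum_neg_one_pow_choose_add_mul_choose_succ N l (mem_range.1 hl)]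
    split_ifs with h
    · simp [h]
    · simp
  rw [hexpand, sum_congr rfl fun l hl => sum_congr rfl (hterm l hl)]
  simp only [sum_sub_distrib]
  rw [sum_alternating_choose_mul_symm N hN (fun a b => inner ℝ (G a) (G b))
    (fun a b => real_inner_comm _ _) (fun b => by simp [hGN]), sum_congr rfl hmain,
    real_inner_self_eq_norm_sq, hG0]
  have hN' : (N : ℝ) ≠ 0 := by positivity
  simp [hN]
  field_simp

/-- If the certificates are nonnegative, then so is the total weighted monotonicity slack, and
this bounds the last residual. -/
theorem norm_sq_le_inner_of_certMatrix_nonpos {E : Type*} [NormedAddCommGroup E]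
    [InnerProductSpace ℝ E]
    (N : ℕ) (hN : 0 < N) (q S : ℕ → ℕ → ℝ) (g x : ℕ → E) (x₀ : E)
    (hq0 : ∀ j < N, q 0 j = if j = N - 1 then 1 else 0)
    (hstep : ∀ m, ∀ l < N, q (m + 1) l = ∑ k ∈ range N, q m k * S k l)
    (hqN : ∀ j < N, q N j = 0)
    (hsum : ∀ m < N, ∑ j ∈ range N, q m j = 1 / (N : ℝ) * (N.choose (m + 1) : ℝ))
    (hx : ∀ k < N, x k = x₀ - ∑ l ∈ range N, S k l • g l - (1 / 2 : ℝ) • g k)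
    (hcert : ∀ k j, j < k → k < N → certMatrix N q k j ≤ 0)
    (hmono : ∀ k j, 0 ≤ inner ℝ (x k - x j) (g k - g j)) :
    (N : ℝ) / 2 * ‖g (N - 1)‖ ^ 2 ≤ inner ℝ (x₀ - x (N - 1)) (g (N - 1)) := by
  have hrow : ∑ k ∈ range N, ∑ j ∈ range N, certMatrix N q k j * inner ℝ (x k) (g k)
      = inner ℝ (x (N - 1)) (g (N - 1)) := by
    have : ∀ k ∈ range N, ∑ j ∈ range N, certMatrix N q k j * inner ℝ (x k) (g k)
        = if k = N - 1 then inner ℝ (x k) (g k) else 0 := by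
      intro k hk
      rw [← sum_mul, sum_certMatrix N q k hsum hN, hq0 k (mem_range.1 hk)]
      split_ifs <;> simp
    rw [sum_congr rfl this]
    simp
    omega
  have hcol : ∑ k ∈ range N, ∑ j ∈ range N, certMatrix N q k j * inner ℝ (x j) (g j)
      = inner ℝ (x (N - 1)) (g (N - 1)) := by
    rw [← hrow, sum_comm]
    exact sum_congr rfl fun k _ => sum_congr rfl fun j _ => by rw [certMatrix_symm]
  have hcross := sum_certMatrix_mul_inner N hN q S g x x₀ hq0 hstep hqN hsum hx
  have hcross' : ∑ k ∈ range N, ∑ j ∈ range N, certMatrix N q k j * inner ℝ (x j) (g k)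
      = inner ℝ x₀ (g (N - 1)) - (N : ℝ) / 2 * ‖g (N - 1)‖ ^ 2 := by
    rw [← hcross, sum_comm]
    exact sum_congr rfl fun k _ => sum_congr rfl fun j _ => by rw [certMatrix_symm]
  have hle : ∑ k ∈ range N, ∑ j ∈ range N,
      certMatrix N q k j * inner ℝ (x k - x j) (g k - g j) ≤ 0 := by
    refine sum_nonpos fun k hk => sum_nonpos fun j hj => ?_
    rcases lt_trichotomy j k with h | h | h
    · exact mul_nonpos_of_nonpos_of_nonneg (hcert k j h (mem_range.1 hk)) (hmono k j)
    · simp [h]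
    · rw [certMatrix_symm]
      exact mul_nonpos_of_nonpos_of_nonneg (hcert j k h (mem_range.1 hj)) (hmono k j)
  have hsplit : ∀ k j, certMatrix N q k j * inner ℝ (x k - x j) (g k - g j)
      = certMatrix N q k j * inner ℝ (x k) (g k) - certMatrix N q k j * inner ℝ (x k) (g j)
        - certMatrix N q k j * inner ℝ (x j) (g k) + certMatrix N q k j * inner ℝ (x j) (g j) := by
    intro k j
    simp only [inner_sub_left, inner_sub_right]
    ring
  simp only [hsplit, sum_add_distrib, sum_sub_distrib] at hle
  rw [hrow, hcol, hcross, hcross'] at hle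
  rw [inner_sub_left]
  linarith

/-- The index sequences appearing in `Qinv` and `Pinv`: `1 ≤ j(r) ≤ i(r)` and `i(r) < j(r+1)`. -/
def IsInterlaced {k m : ℕ} (f : Fin (m + 1) → Fin (k + 1) × Fin (k + 1)) : Prop :=
  (∀ r, 1 ≤ ((f r).2 : ℕ) ∧ ((f r).2 : ℕ) ≤ ((f r).1 : ℕ)) ∧
    (∀ r : Fin m, ((f r.castSucc).1 : ℕ) < ((f r.succ).2 : ℕ))

theorem isInterlaced_cons {k m : ℕ} (p : Fin (k + 1) × Fin (k + 1))
    (f : Fin (m + 1) → Fin (k + 1) × Fin (k + 1)) :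
    IsInterlaced (Fin.cons p f : Fin (m + 2) → Fin (k + 1) × Fin (k + 1)) ↔
      ((1 ≤ (p.2 : ℕ) ∧ (p.2 : ℕ) ≤ (p.1 : ℕ)) ∧ (p.1 : ℕ) < ((f 0).2 : ℕ)) ∧ IsInterlaced f := by
  unfold IsInterlaced
  rw [Fin.forall_fin_succ, Fin.forall_fin_succ (P := fun r : Fin (m + 1) =>
    (((Fin.cons p f : Fin (m + 2) → Fin (k + 1) × Fin (k + 1)) r.castSucc).1 : ℕ) <
      (((Fin.cons p f : Fin (m + 2) → Fin (k + 1) × Fin (k + 1)) r.succ).2 : ℕ))]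
  simp only [Fin.cons_zero, Fin.cons_succ, Fin.castSucc_zero, ← Fin.succ_castSucc]
  tauto

open Classical in
theorem Qinv_succ_eq (H : ℕ → ℕ → ℝ) (k m j : ℕ) :
    Qinv H k (m + 1) j = ∑ f : Fin (m + 1) → Fin (k + 1) × Fin (k + 1),
      if IsInterlaced f then
        (if ((f 0).2 : ℕ) = j then ∏ r, H ((f r).1 : ℕ) ((f r).2 : ℕ) else 0) else 0 := by
  rw [Qinv]
  refine sum_congr rfl fun f _ => ?_
  rw [← ite_and]
  exact if_congr (by unfold IsInterlaced; tauto) rfl rfl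

open Classical in
theorem Pinv_succ_eq (H : ℕ → ℕ → ℝ) (k m : ℕ) :
    Pinv H k (m + 1) = ∑ f : Fin (m + 1) → Fin (k + 1) × Fin (k + 1),
      if IsInterlaced f then ∏ r, H ((f r).1 : ℕ) ((f r).2 : ℕ) else 0 := by
  rw [Pinv]
  exact sum_congr rfl fun f _ => if_congr Iff.rfl rfl rfl

theorem Pinv_succ_eq_sum_Qinv (H : ℕ → ℕ → ℝ) (k m : ℕ) :
    Pinv H k (m + 1) = ∑ j ∈ range k, Qinv H k (m + 1) (j + 1) := by
  classical
  simp only [Pinv_succ_eq, Qinv_succ_eq]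
  rw [sum_comm]
  refine sum_congr rfl fun f _ => ?_
  split_ifs with hf
  · have h1 := (hf.1 0).1
    have h2 := (f 0).2.isLt
    rw [sum_eq_single (((f 0).2 : ℕ) - 1)]
    · rw [if_pos (by omega)]
    · intro b _ hb
      rw [if_neg (by omega)]
    · intro hb
      rw [mem_range] at hb
      omega
  · simp

/-- Inner sum over the first pair of an interlaced sequence. -/
theorem sum_first_pair (H : ℕ → ℕ → ℝ) (k j b : ℕ) (hb : b ≤ k + 1) :
    ∑ p : Fin (k + 1) × Fin (k + 1),
      (if ((1 ≤ (p.2 : ℕ) ∧ (p.2 : ℕ) ≤ (p.1 : ℕ)) ∧ (p.1 : ℕ) < b) ∧ (p.2 : ℕ) = j + 1 then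
        H (p.1 : ℕ) (p.2 : ℕ) else 0)
      = ∑ i ∈ range (b - 1), if j ≤ i then H (i + 1) (j + 1) else 0 := by
  rw [Fintype.sum_prod_type]
  have h1 : ∀ a : Fin (k + 1), ∑ c : Fin (k + 1),
      (if ((1 ≤ (c : ℕ) ∧ (c : ℕ) ≤ (a : ℕ)) ∧ (a : ℕ) < b) ∧ (c : ℕ) = j + 1 then
        H (a : ℕ) (c : ℕ) else 0)
      = if j + 1 ≤ (a : ℕ) ∧ (a : ℕ) < b then H (a : ℕ) (j + 1) else 0 := by
    intro a
    split_ifs with h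
    · have ha := a.isLt
      rw [sum_eq_single (⟨j + 1, by omega⟩ : Fin (k + 1))]
      · exact if_pos ⟨⟨⟨Nat.succ_pos j, h.1⟩, h.2⟩, rfl⟩
      · intro c _ hc
        rw [if_neg]
        rintro ⟨-, h2⟩
        exact hc (Fin.ext h2)
      · simp
    · refine sum_eq_zero fun c _ => if_neg ?_
      omega
  simp only [h1]
  rw [Fin.sum_univ_eq_sum_range
    (fun a => if j + 1 ≤ a ∧ a < b then H a (j + 1) else 0) (k + 1), sum_range_succ']
  rw [if_neg (by omega), add_zero]
  rw [← sum_subset (range_subset_range.2 (show b - 1 ≤ k by omega))]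
  · refine sum_congr rfl fun i hi => if_congr ?_ rfl rfl
    rw [mem_range] at hi
    omega
  · intro i _ hi
    rw [mem_range] at hi
    exact if_neg (by omega)

theorem Qinv_one (H : ℕ → ℕ → ℝ) (k j : ℕ) :
    Qinv H k 1 (j + 1) = ∑ i ∈ range k, if j ≤ i then H (i + 1) (j + 1) else 0 := by
  classical
  have h := sum_first_pair H k j (k + 1) le_rfl
  rw [add_tsub_cancel_right] at h
  rw [← h, Qinv_succ_eq, ← (Equiv.funUnique (Fin 1) (Fin (k + 1) × Fin (k + 1))).symm.sum_comp]
  refine sum_congr rfl fun p _ => ?_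
  have := p.1.isLt
  rw [← ite_and]
  refine if_congr ?_ ?_ rfl
  · simp [IsInterlaced]
    omega
  · simp

/-- Splitting off the first pair gives the recursion defining `Qinv` from shorter sequences. -/
theorem Qinv_succ_succ (H : ℕ → ℕ → ℝ) (k m j : ℕ) :
    Qinv H k (m + 2) (j + 1) = ∑ b ∈ range k, Qinv H k (m + 1) (b + 1) *
      ∑ i ∈ range b, if j ≤ i then H (i + 1) (j + 1) else 0 := by
  classical
  rw [Qinv_succ_eq, ← (Fin.consEquiv fun _ => Fin (k + 1) × Fin (k + 1)).sum_comp,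
    Fintype.sum_prod_type, sum_comm]
  simp only [Qinv_succ_eq, sum_mul]
  conv_rhs => rw [sum_comm]
  refine sum_congr rfl fun f _ => ?_
  by_cases hf : IsInterlaced f
  · have h1 := (hf.1 0).1
    have h2 := (f 0).2.isLt
    rw [sum_eq_single (((f 0).2 : ℕ) - 1)]
    · rw [if_pos hf, if_pos (by omega), ← sum_first_pair H k j _ h2.le, mul_sum]
      refine sum_congr rfl fun p _ => ?_
      simp only [Fin.consEquiv_apply, Fin.cons_zero]
      rw [← ite_and, mul_ite, mul_zero]
      refine if_congr (and_congr_left' ((isInterlaced_cons p f).trans (and_iff_left hf))) ?_ rfl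
      rw [Fin.prod_univ_succ, mul_comm]
      simp
    · intro b _ hb
      rw [if_pos hf, if_neg (by omega), zero_mul]
    · intro hb
      rw [mem_range] at hb
      omega
  · simp [isInterlaced_cons, hf, Fin.consEquiv]

/-- The coefficient vectors on indices `0, …, n`: the last unit vector followed by the partial
sums `Qinv`. -/
noncomputable def certCoeff (n : ℕ) (H : ℕ → ℕ → ℝ) : ℕ → ℕ → ℝ
  | 0, j => if j = n then 1 else 0
  | m + 1, j => Qinv H n (m + 1) (j + 1)

/-- Accumulated step sizes: the coefficient of the `j`-th residual in `y 0 - y k`. -/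
noncomputable def stepSum (H : ℕ → ℕ → ℝ) (k j : ℕ) : ℝ :=
  ∑ i ∈ range k, if j ≤ i then H (i + 1) (j + 1) else 0

theorem stepSum_eq_zero (H : ℕ → ℕ → ℝ) {k j : ℕ} (h : k ≤ j) : stepSum H k j = 0 :=
  sum_eq_zero fun i hi => if_neg (by rw [mem_range] at hi; omega)

theorem Qinv_eq_zero_of_lt (H : ℕ → ℕ → ℝ) (k m j : ℕ) (h : k < j) : Qinv H k (m + 1) j = 0 := by
  rw [Qinv]
  refine sum_eq_zero fun f _ => if_neg ?_
  have := (f 0).2.isLt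
  omega

theorem certCoeff_succ (n : ℕ) (H : ℕ → ℕ → ℝ) (m j : ℕ) :
    certCoeff n H (m + 1) j = ∑ k ∈ range (n + 1), certCoeff n H m k * stepSum H k j := by
  rcases m with _ | m
  · simp [certCoeff, Qinv_one, stepSum]
  · simp only [certCoeff]
    rw [Qinv_succ_succ, sum_range_succ, Qinv_eq_zero_of_lt H n m (n + 1) (by omega), zero_mul,
      add_zero]
    rfl

theorem certCoeff_eq_zero (n : ℕ) (H : ℕ → ℕ → ℝ) (m : ℕ) :
    ∀ j, n < m + j → certCoeff n H m j = 0 := by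
  induction m with
  | zero => intro j hj; exact if_neg (by omega)
  | succ m ih =>
    intro j hj
    rw [certCoeff_succ]
    refine sum_eq_zero fun k _ => ?_
    by_cases hk : k ≤ j
    · rw [stepSum_eq_zero H hk, mul_zero]
    · rw [ih k (by omega), zero_mul]

theorem sum_certCoeff (n : ℕ) (H : ℕ → ℕ → ℝ)
    (hinv : ∀ m, 1 ≤ m → m ≤ n →
      Pinv H n m = 1 / ((n + 1 : ℕ) : ℝ) * ((n + 1).choose (m + 1) : ℝ)) (m : ℕ) (hm : m < n + 1) :
    ∑ j ∈ range (n + 1), certCoeff n H m j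
      = 1 / ((n + 1 : ℕ) : ℝ) * ((n + 1).choose (m + 1) : ℝ) := by
  rcases m with _ | m
  · have : ((n + 1 : ℕ) : ℝ) ≠ 0 := by positivity
    rw [zero_add, Nat.choose_one_right, one_div_mul_cancel this]
    simp [certCoeff]
  · rw [← hinv (m + 1) (by omega) (by omega), Pinv_succ_eq_sum_Qinv, sum_range_succ,
      certCoeff_eq_zero n H (m + 1) n (by omega), add_zero]
    rfl

theorem sum_Icc_eq_sum_range_certCoeff (n : ℕ) (H : ℕ → ℕ → ℝ) (c : ℕ → ℝ) (j : ℕ) (hj : j < n) :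
    ∑ m ∈ Icc 1 (n + 1 - (j + 1)), c m * Qinv H n m (j + 1)
      = ∑ m ∈ range (n + 1), c m * certCoeff n H m j := by
  rw [← sum_subset (show Icc 1 (n + 1 - (j + 1)) ⊆ range (n + 1) by
    intro m hm; rw [mem_Icc] at hm; rw [mem_range]; omega)]
  · refine sum_congr rfl fun m hm => ?_
    rw [mem_Icc] at hm
    obtain ⟨m, rfl⟩ := Nat.exists_eq_add_of_le' hm.1
    rfl
  · intro m _ hm
    rw [mem_Icc] at hm
    rcases m with _ | m
    · simp [certCoeff, hj.ne]
    · rw [certCoeff_eq_zero n H (m + 1) j (by omega), mul_zero]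

theorem lamStar_eq_neg_certMatrix (n : ℕ) (H : ℕ → ℕ → ℝ) (k j : ℕ) (hjk : j < k) (hk : k ≤ n) :
    lamStar (n + 1) H (k + 1) (j + 1) = -certMatrix (n + 1) (certCoeff n H) k j := by
  have hj : j < n := by omega
  unfold lamStar certMatrix
  rw [← mul_neg, add_tsub_cancel_right]
  split_ifs with h
  · obtain rfl : k = n := by omega
    congr 1
    rw [← sum_neg_distrib]
    have h1 : ∀ l ∈ range (k + 1), -∑ m ∈ range (k + 1), (-1 : ℝ) ^ (l + m) *
        ((l + m).choose m : ℝ) * (certCoeff k H l j * certCoeff k H m k)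
        = -(-1 : ℝ) ^ l * certCoeff k H l j := by
      intro l _
      rw [sum_range_succ', sum_eq_zero fun m _ => ?_]
      · simp [certCoeff]
      · rw [certCoeff_eq_zero k H (m + 1) k (by omega), mul_zero, mul_zero]
    rw [sum_congr rfl h1, ← sum_Icc_eq_sum_range_certCoeff k H (fun l => -(-1 : ℝ) ^ l) j hj]
    refine sum_congr rfl fun m hm => ?_
    rw [mem_Icc] at hm
    obtain ⟨m, rfl⟩ := Nat.exists_eq_add_of_le' hm.1
    rw [add_tsub_cancel_right]
    ring
  · congr 1
    rw [← sum_neg_distrib]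
    have h1 : ∀ l ∈ range (n + 1), -∑ m ∈ range (n + 1), (-1 : ℝ) ^ (l + m) *
        ((l + m).choose m : ℝ) * (certCoeff n H l j * certCoeff n H m k)
        = (-∑ m ∈ Icc 1 (n + 1 - (k + 1)), (-1 : ℝ) ^ (l + m) * ((l + m).choose m : ℝ) *
            Qinv H n m (k + 1)) * certCoeff n H l j := by
      intro l _
      rw [sum_Icc_eq_sum_range_certCoeff n H
        (fun m => (-1 : ℝ) ^ (l + m) * ((l + m).choose m : ℝ)) k (by omega), neg_mul, sum_mul]
      congr 1
      exact sum_congr rfl fun m _ => by ring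
    rw [sum_congr rfl h1, ← sum_Icc_eq_sum_range_certCoeff n H (fun l =>
      -∑ m ∈ Icc 1 (n + 1 - (k + 1)), (-1 : ℝ) ^ (l + m) * ((l + m).choose m : ℝ) *
            Qinv H n m (k + 1)) j hj]
    refine sum_congr rfl fun l hl => ?_
    rw [mem_Icc] at hl
    obtain ⟨l, rfl⟩ := Nat.exists_eq_add_of_le' hl.1
    rw [neg_mul, sum_mul, ← sum_neg_distrib]
    refine sum_congr rfl fun m _ => ?_
    rw [show l + 1 + m - 1 = l + m by omega, show l + 1 + m = l + m + 1 by omega]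
    ring

/-- Nonexpansiveness of `T` as monotonicity: with `g = y - T y` and `x = y - g / 2`. -/
theorem inner_sub_half_residual_nonneg {E : Type*} [NormedAddCommGroup E] [InnerProductSpace ℝ E]
    {T : E → E} (hT : ∀ x y, ‖T x - T y‖ ≤ ‖x - y‖) (u v : E) :
    0 ≤ inner ℝ ((u - (1 / 2 : ℝ) • (u - T u)) - (v - (1 / 2 : ℝ) • (v - T v)))
      ((u - T u) - (v - T v)) := by
  have h1 : (u - (1 / 2 : ℝ) • (u - T u)) - (v - (1 / 2 : ℝ) • (v - T v))
      = (1 / 2 : ℝ) • ((u - v) + (T u - T v)) := by module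
  have h2 : (u - T u) - (v - T v) = (u - v) - (T u - T v) := by abel
  rw [h1, h2, real_inner_smul_left]
  have h3 := pow_le_pow_left₀ (norm_nonneg _) (hT u v) 2
  generalize u - v = a at *
  generalize T u - T v = b at *
  rw [inner_add_left, inner_sub_right, inner_sub_right, real_inner_self_eq_norm_sq,
    real_inner_self_eq_norm_sq, real_inner_comm a b]
  linarith

theorem iterate_eq_sub_sum_stepSum {E : Type*} [AddCommGroup E] [Module ℝ E] (n : ℕ)
    (H : ℕ → ℕ → ℝ) (y g : ℕ → E)
    (hy : ∀ k < n, y (k + 1) = y k - ∑ j ∈ range (k + 1), H (k + 1) (j + 1) • g j) (k : ℕ)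
    (hk : k ≤ n) : y k = y 0 - ∑ l ∈ range (n + 1), stepSum H k l • g l := by
  induction k with
  | zero => simp [stepSum]
  | succ k ih =>
    have h1 : ∀ l, stepSum H (k + 1) l = stepSum H k l + if l ≤ k then H (k + 1) (l + 1) else 0 :=
      fun l => sum_range_succ _ _
    have h2 : ∑ j ∈ range (k + 1), H (k + 1) (j + 1) • g j
        = ∑ l ∈ range (n + 1), (if l ≤ k then H (k + 1) (l + 1) else 0) • g l := by
      rw [← sum_subset (range_subset_range.2 (show k + 1 ≤ n + 1 by omega))]
      · refine sum_congr rfl fun l hl => ?_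
        rw [mem_range] at hl
        rw [if_pos (by omega)]
      · intro l _ hl
        rw [mem_range] at hl
        rw [if_neg (by omega), zero_smul]
    rw [hy k (by omega), ih (by omega), h2]
    simp only [h1, add_smul, sum_add_distrib]
    abel

/-- **Sufficiency: H-invariance plus nonnegative H-certificates imply optimality.**
If `P(N−1,m;H) = (1/N)·C(N,m+1)` for `m = 1,…,N−1` and `λ*_{k,j}(H) ≥ 0` for all
`1 ≤ j < k ≤ N`, then for every `d ≥ 1`, every nonexpansive `T : ℝ^d → ℝ^d` with a fixed
point `y⋆`, and every `y₀`, the H-matrix algorithm iterates satisfy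
`‖y_{N−1} − T y_{N−1}‖² ≤ 4‖y₀ − y⋆‖²/N²`. -/
theorem hinvariance_with_certificates_sufficient (N : ℕ) (hN : 2 ≤ N) (H : ℕ → ℕ → ℝ)
    (hinv : ∀ m, 1 ≤ m → m ≤ N - 1 →
      Pinv H (N - 1) m = 1 / (N : ℝ) * (Nat.choose N (m + 1) : ℝ))
    (hcert : ∀ k j, 1 ≤ j → j < k → k ≤ N → 0 ≤ lamStar N H k j) :
    ∀ (d : ℕ), 1 ≤ d →
      ∀ (T : EuclideanSpace ℝ (Fin d) → EuclideanSpace ℝ (Fin d)),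
        (∀ x y, ‖T x - T y‖ ≤ ‖x - y‖) →
      ∀ (ystar : EuclideanSpace ℝ (Fin d)), T ystar = ystar →
      ∀ (y0 : EuclideanSpace ℝ (Fin d)) (y : ℕ → EuclideanSpace ℝ (Fin d)),
        y 0 = y0 →
        (∀ k, k < N - 1 →
          y (k + 1) = y k - ∑ j ∈ Finset.range (k + 1), H (k + 1) (j + 1) • (y j - T (y j))) →
        ‖y (N - 1) - T (y (N - 1))‖ ^ 2 ≤ 4 * ‖y0 - ystar‖ ^ 2 / (N : ℝ) ^ 2 := by
  intro d _ T hT ystar hfix y0 y hy0 hy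
  obtain ⟨n, rfl⟩ : ∃ n, N = n + 1 := ⟨N - 1, by omega⟩
  simp only [add_tsub_cancel_right] at hinv hy ⊢
  have hcert' : ∀ k j, j < k → k < n + 1 → certMatrix (n + 1) (certCoeff n H) k j ≤ 0 := by
    intro k j hjk hk
    have h := hcert (k + 1) (j + 1) (by omega) (by omega) (by omega)
    rw [lamStar_eq_neg_certMatrix n H k j hjk (by omega)] at h
    linarith
  have hbound := norm_sq_le_inner_of_certMatrix_nonpos (n + 1) n.succ_pos (certCoeff n H)
    (stepSum H) (fun k => y k - T (y k)) (fun k => y k - (1 / 2 : ℝ) • (y k - T (y k))) y0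
    (fun j _ => rfl) (fun m l _ => certCoeff_succ n H m l)
    (fun j _ => certCoeff_eq_zero n H (n + 1) j (by omega)) (sum_certCoeff n H hinv)
    (fun k hk => by
      have h := iterate_eq_sub_sum_stepSum n H y (fun k => y k - T (y k)) hy k (by omega)
      rw [hy0] at h
      exact congrArg (· - (1 / 2 : ℝ) • (y k - T (y k))) h)
    hcert' (fun k j => inner_sub_half_residual_nonneg hT (y k) (y j))
  rw [add_tsub_cancel_right] at hbound
  have hlast := inner_sub_half_residual_nonneg hT (y n) ystar
  rw [hfix, sub_self, smul_zero, sub_zero, sub_zero] at hlast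
  set g := y n - T (y n) with hg
  have hinner : inner ℝ (y0 - ystar) g
      = inner ℝ (y0 - (y n - (1 / 2 : ℝ) • g)) g + inner ℝ (y n - (1 / 2 : ℝ) • g - ystar) g := by
    rw [← inner_add_left]
    congr 1
    abel
  have hcs := real_inner_le_norm (y0 - ystar) g
  have hpos : (0 : ℝ) < ((n + 1 : ℕ) : ℝ) := by positivity
  have hle : ((n + 1 : ℕ) : ℝ) / 2 * ‖g‖ ≤ ‖y0 - ystar‖ := by
    rcases (norm_nonneg g).eq_or_lt with h | h
    · rw [← h, mul_zero]
      exact norm_nonneg _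
    · refine le_of_mul_le_mul_right ?_ h
      rw [mul_assoc, ← sq]
      linarith
  have hsq := pow_le_pow_left₀ (by positivity) hle 2
  rw [le_div_iff₀ (by positivity)]
  linarith [hsq, mul_pow (((n + 1 : ℕ) : ℝ) / 2) ‖g‖ 2, div_pow ((n + 1 : ℕ) : ℝ) 2 2]
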